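/- The Möbius ladder on 6 vertices (vertices 1..6 with edges 12, 23, 34, 45, 56, 61, 14, 25, 36) admits no unit-distance embedding in the plane: there is no injective map f: {1,...,6} → R^2 such that |f(u)-f(v)|=1 for all edges uv (even without requiring non-edges to have distance ≠ 1). -/

import Mathlib

/-- The Möbius ladder on 6 vertices (edges 12, 23, 34, 45, 56, 61, 14, 25, 36, here
written 0-based) admits no injective unit-distance representation in the plane. -/
theorem mobius_ladder_not_planar :
    ¬ ∃ f : Fin 6 → EuclideanSpace ℝ (Fin 2),
      Function.Injective f ∧
      dist (f 0) (f 1) = 1 ∧ dist (f 1) (f 2) = 1 ∧ dist (f 2) (f 3) = 1 ∧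
      dist (f 3) (f 4) = 1 ∧ dist (f 4) (f 5) = 1 ∧ dist (f 5) (f 0) = 1 ∧
      dist (f 0) (f 3) = 1 ∧ dist (f 1) (f 4) = 1 ∧ dist (f 2) (f 5) = 1 := by
  rintro ⟨f, hf, h01, h12, h23, h34, h45, h50, h03, h14, h25⟩
  have h02 : f 0 ≠ f 2 := fun h => absurd (hf h) (by decide)
  have h13 : f 1 ≠ f 3 := fun h => absurd (hf h) (by decide)
  rcases EuclideanGeometry.eq_of_dist_eq_of_dist_eq_of_finrank_eq_two
    (p := f 5) (by simp) h02 h13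
    ((dist_comm _ _).trans h01) ((dist_comm _ _).trans h03) h50
    h12 ((dist_comm _ _).trans h23) ((dist_comm _ _).trans h25) with h | h
  · exact absurd (hf h) (by decide)
  · exact absurd (hf h) (by decide)
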